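/- Let r = (R_j)_{j≥1} be a generic sequence of radii, let k ≥ 1, and let ε = (ε_j)_{j≥2} (positive reals with ε_j < R_j), m = (m_j)_{j≥1}, ℓ = (ℓ_j)_{j≥2} be sequences such that condition (3.3) for k+1 holds and condition (3.4) for k holds. If c ∈ C(r) and c' ∈ U_{k+1}(c, ε_{k+1}), then for every z ∈ ℂ_p, z lies in the cylinder C_c(α^{(k)}) if and only if z lies in the cylinder C_{c'}(α^{(k)}). -/

import Mathlib

noncomputable section

/-- `K` is a model of `ℂ_p`, the completion of an algebraic closure of `ℚ_p`:
it is a complete, algebraically closed, nonarchimedean normed field whose norm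
extends the `p`-adic absolute value and in which the algebraic elements over
`ℚ_p` are dense. -/
structure IsCp (p : ℕ) [Fact p.Prime] (K : Type*) [NormedField K] [Algebra ℚ_[p] K] : Prop where
  complete : CompleteSpace K
  norm_extends : ∀ x : ℚ_[p], ‖algebraMap ℚ_[p] K x‖ = ‖x‖
  isAlgClosed : IsAlgClosed K
  dense_algebraic : Dense {x : K | IsAlgebraic ℚ_[p] x}
  isNonarch : ∀ x y : K, ‖x + y‖ ≤ max ‖x‖ ‖y‖

/-- `ϱ = p^{-1/(p-1)}`. -/
def rho (p : ℕ) : ℝ := (p : ℝ) ^ (-1 / ((p : ℝ) - 1))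

/-- `R` is a sequence of radii: strictly increasing (for indices `≥ 1`),
with `R 1 > p`, tending to infinity. -/
def IsRadii (p : ℕ) (R : ℕ → ℝ) : Prop :=
  (∀ j, 1 ≤ j → R j < R (j + 1)) ∧ (p : ℝ) < R 1 ∧
    Filter.Tendsto R Filter.atTop Filter.atTop

/-- The piecewise-monomial map `φ`: for `R_{j-1} < t ≤ R_j` (with `R_0 := 0`),
`φ(t) = p (R_1 ⋯ R_{j-1})⁻¹ t^{p+j-1}`. -/
def phi (p : ℕ) (R : ℕ → ℝ) (t : ℝ) : ℝ :=
  let j := sInf {j : ℕ | 1 ≤ j ∧ t ≤ R j}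
  (p : ℝ) * (∏ i ∈ Finset.Icc 1 (j - 1), R i)⁻¹ * t ^ (p + j - 1)

/-- A generic sequence of radii. -/
def IsGenericRadii (p : ℕ) (R : ℕ → ℝ) : Prop :=
  IsRadii p R ∧ ∀ i j n : ℕ, 1 ≤ i → i < j → 1 ≤ n → (phi p R)^[n] (R i) ≠ R j

/-- Membership in the parameter space `C(r)`: `|c_j| = R_j` for all `j ≥ 1`. -/
def InC (p : ℕ) [Fact p.Prime] {K : Type*} [NormedField K] (R : ℕ → ℝ) (c : ℕ → K) : Prop :=
  ∀ j, 1 ≤ j → ‖c j‖ = R j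

/-- The transcendental entire map `f_c(z) = (z^p/p) ∏_{j ≥ 1} (1 - z/c_j)`. -/
def fc (p : ℕ) {K : Type*} [NormedField K] (c : ℕ → K) (z : K) : K :=
  z ^ p / (p : K) * ∏' j : ℕ, (1 - z / c (j + 1))

/-- The disk `B_0 = {|z| < 1}` for `j = 0`, and `B_j = {|z - c_j| < R_j}` for `j ≥ 1`. -/
def Bset {K : Type*} [NormedField K] (R : ℕ → ℝ) (c : ℕ → K) (j : ℕ) : Set K :=
  if j = 0 then {z : K | ‖z‖ < 1} else {z : K | ‖z - c j‖ < R j}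

/-- The set `A`, complement of all the disks `B_j`, `j ≥ 0`. -/
def Aset {K : Type*} [NormedField K] (R : ℕ → ℝ) (c : ℕ → K) : Set K :=
  (⋃ j, Bset R c j)ᶜ

/-- `n_j`, the minimal `n ≥ 1` with `R_j < φ^{∘(n+1)}(1)`. -/
def nseq (p : ℕ) (R : ℕ → ℝ) (j : ℕ) : ℕ :=
  sInf {n : ℕ | 1 ≤ n ∧ R j < (phi p R)^[n + 1] 1}

/-- `S_j = φ⁻¹(R_j)`. -/
def Sse (p : ℕ) (R : ℕ → ℝ) (j : ℕ) : ℝ := Function.invFun (phi p R) (R j)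

/-- `λ_j = φ(R_j)/R_j`. -/
def lam (p : ℕ) (R : ℕ → ℝ) (j : ℕ) : ℝ := phi p R (R j) / R j

/-- `L_k`: index of the first symbol of the `k`-th block `B_0^{m_k} A^{n_k} B_k^{…}`
of the itinerary `α(m, ℓ)`; `L_1 = 0` and `L_{k+1} = L_k + m_k + n_k + ℓ_{k+1}`. -/
def Lseq (m n l : ℕ → ℕ) : ℕ → ℕ
  | 0 => 0
  | 1 => 0
  | k + 2 => Lseq m n l (k + 1) + m (k + 1) + n (k + 1) + l (k + 2)

/-- `N_k = L_k + m_k + n_k`, the index of the final symbol `B_k` of the truncated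
itinerary `α^{(k)}` (so `α^{(k)}` has length `N_k + 1`). -/
def Nseq (m n l : ℕ → ℕ) (k : ℕ) : ℕ := Lseq m n l k + m k + n k

/-- The symbol (`some 0 = B_0`, `none = A`, `some k = B_k`) at position `i` of the
itinerary `α(m,ℓ) = B_0^{m_1} A^{n_1} B_1^{ℓ_2} B_0^{m_2} A^{n_2} B_2^{ℓ_3} ⋯`. -/
def itin (m n l : ℕ → ℕ) (i : ℕ) : Option ℕ :=
  let k := sSup {k : ℕ | 1 ≤ k ∧ Lseq m n l k ≤ i}
  if i < Lseq m n l k + m k then some 0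
  else if i < Lseq m n l k + m k + n k then none
  else some k

/-- The subset of `ℂ_p` corresponding to a symbol of the alphabet `{A, B_0, B_1, …}`. -/
def symbSet {K : Type*} [NormedField K] (R : ℕ → ℝ) (c : ℕ → K) : Option ℕ → Set K
  | none => Aset R c
  | some j => Bset R c j

/-- Condition (3.2) at `k`: `ϱ⁻¹ R_k p^{-m_k} λ_k^{ℓ_{k+1}} < 1`. -/
def Cond32 (p : ℕ) (R : ℕ → ℝ) (m l : ℕ → ℕ) (k : ℕ) : Prop :=
  (rho p)⁻¹ * R k * ((p : ℝ) ^ m k)⁻¹ * lam p R k ^ l (k + 1) < 1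

/-- Condition (3.3) for `k`: for all `2 ≤ j < k`,
`ε_k < ϱ^{k-j} R_k² (R_{j-1} S_{j-1})⁻¹ λ_{j-1}^{-ℓ_j}`. -/
def Cond33 (p : ℕ) (R : ℕ → ℝ) (ε : ℕ → ℝ) (l : ℕ → ℕ) (k : ℕ) : Prop :=
  ∀ j, 2 ≤ j → j < k →
    ε k < rho p ^ (k - j) * R k ^ 2 * (R (j - 1) * Sse p R (j - 1))⁻¹ *
      (lam p R (j - 1) ^ l j)⁻¹

/-- Condition (3.4) for `k`: for all `2 ≤ j ≤ k`,
`ϱ^{-2} R_{j-1} S_{j-1} λ_{j-1}^{ℓ_j} p^{-m_j} < 1`. -/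
def Cond34 (p : ℕ) (R : ℕ → ℝ) (m l : ℕ → ℕ) (k : ℕ) : Prop :=
  ∀ j, 2 ≤ j → j ≤ k →
    ((rho p) ^ 2)⁻¹ * (R (j - 1) * Sse p R (j - 1)) * lam p R (j - 1) ^ l j *
      ((p : ℝ) ^ m j)⁻¹ < 1

/-- Condition (3.5) at `k`: `p ϱ⁻¹ R_{k+1}² S_k⁻¹ λ_k^{-ℓ_{k+1}} < ε_{k+1}`. -/
def Cond35 (p : ℕ) (R : ℕ → ℝ) (ε : ℕ → ℝ) (l : ℕ → ℕ) (k : ℕ) : Prop :=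
  (p : ℝ) * (rho p)⁻¹ * R (k + 1) ^ 2 * (Sse p R k)⁻¹ * (lam p R k ^ l (k + 1))⁻¹ < ε (k + 1)

/-- `c' ∈ Δ_k(c, ε)`. -/
def InDelta (p : ℕ) [Fact p.Prime] {K : Type*} [NormedField K] (R : ℕ → ℝ) (c : ℕ → K)
    (ε : ℕ → ℝ) (k : ℕ) (c' : ℕ → K) : Prop :=
  InC p R c' ∧ (∀ j, 1 ≤ j → j < k → c' j = c j) ∧ ∀ j, k ≤ j → ‖c' j - c j‖ < ε j

/-- `c' ∈ U_k(c, ε)`. -/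
def InU (p : ℕ) [Fact p.Prime] {K : Type*} [NormedField K] (R : ℕ → ℝ) (c : ℕ → K)
    (k : ℕ) (ε : ℝ) (c' : ℕ → K) : Prop :=
  InC p R c' ∧ ‖c' k - c k‖ < ε ∧ ∀ j, 1 ≤ j → j ≠ k → c' j = c j

open Filter Topology

section Radii

variable {p : ℕ} {R : ℕ → ℝ}

lemma IsRadii.lt (hR : IsRadii p R) {i j : ℕ} (hi : 1 ≤ i) (hij : i < j) : R i < R j := by
  induction j, hij using Nat.le_induction with
  | base => exact hR.1 i hi
  | succ j hj ih => exact ih.trans (hR.1 j (by omega))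

lemma IsRadii.le (hR : IsRadii p R) {i j : ℕ} (hi : 1 ≤ i) (hij : i ≤ j) : R i ≤ R j := by
  rcases hij.eq_or_lt with rfl | h
  · exact le_rfl
  · exact (hR.lt hi h).le

lemma IsRadii.prime_lt (hR : IsRadii p R) {j : ℕ} (hj : 1 ≤ j) : (p : ℝ) < R j :=
  hR.2.1.trans_le (hR.le le_rfl hj)

lemma IsRadii.pos (hR : IsRadii p R) {j : ℕ} (hj : 1 ≤ j) : 0 < R j :=
  (Nat.cast_nonneg p).trans_lt (hR.prime_lt hj)

/-- The partial products `∏_{i ≤ n} max(1, t / R_i)` governing the growth of `f_c`. -/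
def growthProd (R : ℕ → ℝ) (n : ℕ) (t : ℝ) : ℝ := ∏ i ∈ Finset.range n, max 1 (t / R (i + 1))

lemma one_le_growthProd (R : ℕ → ℝ) (n : ℕ) (t : ℝ) : 1 ≤ growthProd R n t :=
  Finset.one_le_prod fun _ _ => le_max_left _ _

lemma IsRadii.growthProd_mono (hR : IsRadii p R) (n : ℕ) {s t : ℝ} (hst : s ≤ t) :
    growthProd R n s ≤ growthProd R n t := by
  refine Finset.prod_le_prod (fun i _ => zero_le_one.trans (le_max_left _ _)) fun i _ => ?_
  have := hR.pos (Nat.le_add_left 1 i)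
  gcongr

lemma IsRadii.growthProd_eq_one (hR : IsRadii p R) (n : ℕ) {t : ℝ} (ht : t ≤ R 1) :
    growthProd R n t = 1 := by
  refine Finset.prod_eq_one fun i _ => max_eq_left ?_
  rw [div_le_one (hR.pos (Nat.le_add_left 1 i))]
  exact ht.trans (hR.le le_rfl (Nat.le_add_left 1 i))

lemma IsRadii.eventually_phi_eq (hR : IsRadii p R) (t : ℝ) :
    ∀ᶠ n in atTop, phi p R t = p * t ^ p * growthProd R n t := by
  have hne : {j : ℕ | 1 ≤ j ∧ t ≤ R j}.Nonempty :=
    ((eventually_ge_atTop 1).and (hR.2.2.eventually_ge_atTop t)).exists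
  obtain ⟨J, hJ⟩ : ∃ J, sInf {j : ℕ | 1 ≤ j ∧ t ≤ R j} = J + 1 :=
    ⟨_, (Nat.sub_add_cancel (Nat.sInf_mem hne).1).symm⟩
  have hmem := Nat.sInf_mem hne
  rw [hJ] at hmem
  filter_upwards [eventually_ge_atTop J] with n hn
  have hlow : ∏ i ∈ Finset.range J, max 1 (t / R (i + 1)) =
      (∏ i ∈ Finset.Icc 1 J, R i)⁻¹ * t ^ J := by
    have h1 : ∏ i ∈ Finset.Icc 1 J, R i = ∏ i ∈ Finset.range J, R (i + 1) := by
      rw [Finset.range_eq_Ico, Finset.prod_Ico_add' (fun i => R i) 0 J 1]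
      rfl
    rw [h1, ← Finset.prod_inv_distrib]
    conv_rhs => rw [← Finset.card_range J, ← Finset.prod_const, Finset.card_range,
      ← Finset.prod_mul_distrib]
    refine Finset.prod_congr rfl fun i hi => ?_
    have hi' : R (i + 1) < t := by
      by_contra! h
      have := Nat.sInf_le (s := {j : ℕ | 1 ≤ j ∧ t ≤ R j}) ⟨Nat.le_add_left 1 i, h⟩
      rw [hJ] at this
      have := Finset.mem_range.1 hi
      omega
    rw [max_eq_right, div_eq_inv_mul]
    rw [one_le_div (hR.pos (Nat.le_add_left 1 i))]
    exact hi'.le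
  have hhigh : ∏ i ∈ Finset.Ico J n, max 1 (t / R (i + 1)) = 1 := by
    refine Finset.prod_eq_one fun i hi => max_eq_left ?_
    rw [div_le_one (hR.pos (Nat.le_add_left 1 i))]
    exact hmem.2.trans (hR.le hmem.1 (by have := (Finset.mem_Ico.1 hi).1; omega))
  have : growthProd R n t = (∏ i ∈ Finset.Icc 1 J, R i)⁻¹ * t ^ J := by
    rw [growthProd, ← Finset.prod_range_mul_prod_Ico _ hn, hlow, hhigh, mul_one]
  rw [this, phi]
  simp only [hJ]
  rw [show p + (J + 1) - 1 = p + J by omega, show J + 1 - 1 = J by omega, pow_add]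
  ring

lemma IsRadii.phi_of_le (hR : IsRadii p R) {t : ℝ} (ht : t ≤ R 1) : phi p R t = p * t ^ p := by
  obtain ⟨n, hn⟩ := (hR.eventually_phi_eq t).exists
  rw [hn, hR.growthProd_eq_one n ht, mul_one]

lemma IsRadii.phi_strictMono [hp : Fact p.Prime] (hR : IsRadii p R) {s t : ℝ} (hs : 0 < s)
    (hst : s < t) : phi p R s < phi p R t := by
  obtain ⟨n, hn, hn'⟩ := ((hR.eventually_phi_eq s).and (hR.eventually_phi_eq t)).exists
  rw [hn, hn']
  have h0 : (0 : ℝ) < p := by exact_mod_cast hp.1.pos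
  have h1 : s ^ p < t ^ p := pow_lt_pow_left₀ hst hs.le hp.1.ne_zero
  have h2 := zero_lt_one.trans_le (one_le_growthProd R n s)
  exact mul_lt_mul (mul_lt_mul_of_pos_left h1 h0) (hR.growthProd_mono n hst.le) h2
    (mul_nonneg h0.le (pow_nonneg (hs.trans hst).le p))

lemma IsRadii.mul_le_phi [hp : Fact p.Prime] (hR : IsRadii p R) {t : ℝ} (ht : 1 ≤ t) :
    p * t ≤ phi p R t := by
  obtain ⟨n, hn⟩ := (hR.eventually_phi_eq t).exists
  rw [hn]
  have h1 : t ≤ t ^ p := le_self_pow₀ ht hp.1.ne_zero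
  calc (p : ℝ) * t ≤ p * t ^ p := by gcongr
    _ ≤ p * t ^ p * growthProd R n t := le_mul_of_one_le_right (by positivity)
        (one_le_growthProd R n t)

lemma IsRadii.lt_phi [hp : Fact p.Prime] (hR : IsRadii p R) {t : ℝ} (ht : 1 ≤ t) :
    t < phi p R t := by
  have h1 : (1 : ℝ) < p := by exact_mod_cast hp.1.one_lt
  refine lt_of_lt_of_le ?_ (hR.mul_le_phi ht)
  nlinarith

lemma IsRadii.phi_mul_le [hp : Fact p.Prime] (hR : IsRadii p R) {s t : ℝ} (hs : 0 < s)
    (hst : s ≤ t) : phi p R s * t ≤ phi p R t * s := by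
  obtain ⟨n, hn, hn'⟩ := ((hR.eventually_phi_eq s).and (hR.eventually_phi_eq t)).exists
  rw [hn, hn']
  have h2 := zero_le_one.trans (one_le_growthProd R n s)
  have h3 := hR.growthProd_mono n hst
  have h4 : s ^ (p - 1) ≤ t ^ (p - 1) := by gcongr
  have ht := hs.trans_le hst
  rw [← Nat.sub_add_cancel hp.1.one_le, pow_succ, pow_succ, Nat.sub_add_cancel hp.1.one_le]
  calc (p : ℝ) * (s ^ (p - 1) * s) * growthProd R n s * t
      = p * s * t * (s ^ (p - 1) * growthProd R n s) := by ring
    _ ≤ p * s * t * (t ^ (p - 1) * growthProd R n t) := by gcongr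
    _ = _ := by ring

lemma IsRadii.pow_le_phi_iterate [hp : Fact p.Prime] (hR : IsRadii p R) (n : ℕ) :
    (p : ℝ) ^ n ≤ (phi p R)^[n] 1 := by
  have h1 : (1 : ℝ) ≤ p := by exact_mod_cast hp.1.one_le
  induction n with
  | zero => simp
  | succ n ih =>
    rw [Function.iterate_succ_apply', pow_succ']
    exact (mul_le_mul_of_nonneg_left ih (by positivity)).trans
      (hR.mul_le_phi ((one_le_pow₀ h1).trans ih))

lemma IsRadii.one_le_nseq [hp : Fact p.Prime] (hR : IsRadii p R) (j : ℕ) : 1 ≤ nseq p R j := by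
  have h1 : (1 : ℝ) < p := by exact_mod_cast hp.1.one_lt
  have hne : {n : ℕ | 1 ≤ n ∧ R j < (phi p R)^[n + 1] 1}.Nonempty := by
    obtain ⟨n, hn⟩ := pow_unbounded_of_one_lt (R j) h1
    refine ⟨n + 1, Nat.le_add_left _ _, hn.trans_le ?_⟩
    exact (pow_le_pow_right₀ h1.le (by omega)).trans (hR.pow_le_phi_iterate _)
  exact (Nat.sInf_mem hne).1

end Radii

section Rho

variable (p : ℕ) [hp : Fact p.Prime]

lemma rho_pos : 0 < rho p := Real.rpow_pos_of_pos (by exact_mod_cast hp.1.pos) _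

lemma rho_pow_pred : rho p ^ (p - 1) = (p : ℝ)⁻¹ := by
  have h1 : (1 : ℝ) < p := by exact_mod_cast hp.1.one_lt
  rw [rho, ← Real.rpow_natCast, ← Real.rpow_mul (by positivity), Nat.cast_sub hp.1.one_le,
    Nat.cast_one, div_mul_cancel₀ _ (by linarith), Real.rpow_neg_one]

lemma rho_lt_one : rho p < 1 := by
  have h1 : (1 : ℝ) < p := by exact_mod_cast hp.1.one_lt
  refine Real.rpow_lt_one_of_one_lt_of_neg h1 (div_neg_of_neg_of_pos (by norm_num) (by linarith))

lemma inv_le_rho : (p : ℝ)⁻¹ ≤ rho p := by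
  rw [← rho_pow_pred]
  exact pow_le_of_le_one (rho_pos p).le (rho_lt_one p).le (by have := hp.1.two_le; omega)

lemma mul_rho_pow : p * rho p ^ p = rho p := by
  have h0 : (p : ℝ) ≠ 0 := by exact_mod_cast hp.1.ne_zero
  rw [← pow_sub_one_mul hp.1.ne_zero, rho_pow_pred, mul_inv_cancel_left₀ h0]

lemma pow_le_div_of_le_rho {e : ℝ} (he0 : 0 ≤ e) (he : e ≤ rho p) : e ^ p ≤ e / p := by
  rw [← pow_sub_one_mul hp.1.ne_zero, div_eq_inv_mul, ← rho_pow_pred]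
  gcongr

end Rho

section Ultrametric

variable {K : Type*} [NormedField K] [IsUltrametricDist K]

lemma norm_mul_sub_mul_le {a a' b b' : K} {A B D : ℝ} (ha' : ‖a'‖ ≤ A)
    (hb : ‖b‖ ≤ B) (hA : ‖a - a'‖ ≤ A * D) (hB : ‖b - b'‖ ≤ B * D) :
    ‖a * b - a' * b'‖ ≤ A * B * D := by
  have hA0 := (norm_nonneg a').trans ha'
  have hB0 := (norm_nonneg b).trans hb
  have hAD := (norm_nonneg _).trans hA
  rw [show a * b - a' * b' = (a - a') * b + a' * (b - b') by ring]
  refine (IsUltrametricDist.norm_add_le_max _ _).trans (max_le ?_ ?_) <;> rw [norm_mul]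
  · calc ‖a - a'‖ * ‖b‖ ≤ A * D * B := by gcongr
      _ = _ := by ring
  · calc ‖a'‖ * ‖b - b'‖ ≤ A * (B * D) := by gcongr
      _ = _ := by ring

lemma norm_prod_sub_prod_le {ι : Type*} (s : Finset ι) {a b : ι → K} {M : ι → ℝ} {D : ℝ}
    (hD : 0 ≤ D) (ha : ∀ i ∈ s, ‖a i‖ ≤ M i) (hb : ∀ i ∈ s, ‖b i‖ ≤ M i)
    (hab : ∀ i ∈ s, ‖a i - b i‖ ≤ M i * D) :
    ‖∏ i ∈ s, a i - ∏ i ∈ s, b i‖ ≤ (∏ i ∈ s, M i) * D := by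
  classical
  induction s using Finset.induction_on with
  | empty => simpa using hD
  | insert i s hi ih =>
    simp only [Finset.forall_mem_insert] at ha hb hab
    rw [Finset.prod_insert hi, Finset.prod_insert hi, Finset.prod_insert hi]
    refine norm_mul_sub_mul_le hb.1 ?_ hab.1 (ih ha.2 hb.2 hab.2)
    rw [norm_prod]
    exact Finset.prod_le_prod (fun _ _ => norm_nonneg _) ha.2

lemma norm_pow_sub_pow_le {z w : K} {r D : ℝ} (hD : 0 ≤ D) (hz : ‖z‖ ≤ r) (hw : ‖w‖ ≤ r)
    (h : ‖z - w‖ ≤ r * D) (n : ℕ) : ‖z ^ n - w ^ n‖ ≤ r ^ n * D := by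
  simpa using norm_prod_sub_prod_le (Finset.range n) (a := fun _ => z) (b := fun _ => w)
    (M := fun _ => r) hD (fun _ _ => hz) (fun _ _ => hw) (fun _ _ => h)

lemma norm_pow_prime_sub_pow_prime_le {p : ℕ} (hp : p.Prime) (hpK : ‖(p : K)‖ = (p : ℝ)⁻¹)
    {z w : K} {t e : ℝ} (he : 0 ≤ e) (he1 : e ≤ 1) (hw : ‖w‖ ≤ t) (h : ‖z - w‖ ≤ t * e) :
    ‖z ^ p - w ^ p‖ ≤ t ^ p * max (e ^ p) (e / p) := by
  obtain ⟨d, rfl⟩ : ∃ d, z = d + w := ⟨z - w, by ring⟩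
  rw [add_sub_cancel_right] at h
  have ht := (norm_nonneg w).trans hw
  have hdt : ‖d‖ ≤ t := h.trans (mul_le_of_le_one_right ht he1)
  rw [add_pow_prime_eq hp, add_right_comm, add_sub_cancel_right]
  refine (IsUltrametricDist.norm_add_le_max _ _).trans ?_
  rw [mul_max_of_nonneg _ _ (pow_nonneg ht p)]
  refine max_le_max ?_ ?_
  · rw [norm_pow, ← mul_pow]
    gcongr
  have hsum : ‖∑ k ∈ Finset.Ioo 0 p, d ^ (k - 1) * w ^ (p - k - 1) * ((p.choose k / p : ℕ) : K)‖
      ≤ t ^ (p - 2) := by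
    refine IsUltrametricDist.norm_sum_le_of_forall_le_of_nonneg (pow_nonneg ht _) fun k hk => ?_
    have hk := Finset.mem_Ioo.1 hk
    rw [norm_mul, norm_mul, norm_pow, norm_pow]
    calc ‖d‖ ^ (k - 1) * ‖w‖ ^ (p - k - 1) * ‖((p.choose k / p : ℕ) : K)‖
        ≤ t ^ (k - 1) * t ^ (p - k - 1) * 1 := by
          gcongr
          exact IsUltrametricDist.norm_natCast_le_one K _
      _ = t ^ (p - 2) := by
          rw [mul_one, ← pow_add]
          congr 1
          omega
  rw [norm_mul, norm_mul, norm_mul, hpK]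
  calc (p : ℝ)⁻¹ * ‖d‖ * ‖w‖ * _ ≤ (p : ℝ)⁻¹ * (t * e) * t * t ^ (p - 2) := by gcongr
    _ = t ^ (p - 2 + 1 + 1) * (e / p) := by rw [pow_succ, pow_succ]; ring
    _ = t ^ p * (e / p) := by rw [show p - 2 + 1 + 1 = p by have := hp.two_le; omega]

lemma norm_one_sub_le (x : K) : ‖1 - x‖ ≤ max 1 ‖x‖ := by
  simpa [sub_eq_add_neg] using IsUltrametricDist.norm_add_le_max (1 : K) (-x)

lemma norm_one_sub_of_norm_ne_one {x : K} (hx : ‖x‖ ≠ 1) : ‖1 - x‖ = max 1 ‖x‖ := by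
  simpa [sub_eq_add_neg] using
    IsUltrametricDist.norm_add_eq_max_of_norm_ne_norm (x := (1 : K)) (y := -x) (by simpa using hx.symm)

lemma norm_eq_of_norm_sub_lt {x y : K} (h : ‖y - x‖ < ‖x‖) : ‖y‖ = ‖x‖ := by
  have := IsUltrametricDist.norm_add_eq_max_of_norm_ne_norm h.ne
  rwa [sub_add_cancel, max_eq_right h.le] at this

lemma norm_le_of_norm_sub_le {x y : K} {r : ℝ} (hx : ‖x‖ ≤ r) (h : ‖y - x‖ ≤ r) : ‖y‖ ≤ r := by
  have := IsUltrametricDist.norm_add_le_max (y - x) x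
  rw [sub_add_cancel] at this
  exact this.trans (max_le h hx)

lemma multipliable_of_tendsto_one [CompleteSpace K] {u : ℕ → K} (hu : Tendsto u atTop (𝓝 1)) :
    Multipliable u := by
  have hev : ∀ δ : ℝ, 0 < δ → ∀ᶠ n in atTop, ∀ i, n ≤ i → ‖u i - 1‖ ≤ δ := fun δ hδ => by
    refine Filter.eventually_atTop.2 ?_
    obtain ⟨N, hN⟩ := Metric.tendsto_atTop.1 hu δ hδ
    exact ⟨N, fun n hn i hi => by simpa [dist_eq_norm] using (hN i (hn.trans hi)).le⟩
  obtain ⟨n₀, hn₀⟩ := (hev 1 one_pos).exists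
  have hle : ∀ i, n₀ ≤ i → ‖u i‖ ≤ 1 := fun i hi =>
    norm_le_of_norm_sub_le (x := 1) (by simp) (hn₀ i hi)
  set M := ‖∏ i ∈ Finset.range n₀, u i‖ with hM
  have hM0 : 0 ≤ M := norm_nonneg _
  refine cauchySeq_tendsto_of_complete (u := fun s : Finset ℕ => ∏ i ∈ s, u i) ?_
  refine Metric.cauchySeq_iff'.2 fun ε hε => ?_
  have hδ : 0 < ε / (2 * (M + 1)) := by positivity
  obtain ⟨n, hn, hn0⟩ := ((hev _ hδ).and (eventually_ge_atTop n₀)).exists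
  refine ⟨Finset.range n, fun s hs => ?_⟩
  have hrange : ‖∏ i ∈ Finset.range n, u i‖ ≤ M := by
    rw [← Finset.prod_range_mul_prod_Ico _ hn0, norm_mul]
    refine mul_le_of_le_one_right hM0 ?_
    rw [norm_prod]
    exact Finset.prod_le_one (fun _ _ => norm_nonneg _) fun i hi => hle i (Finset.mem_Ico.1 hi).1
  have hmem : ∀ i ∈ s \ Finset.range n, n ≤ i := fun i hi => by
    simpa using (Finset.mem_sdiff.1 hi).2
  have hdiff : ‖∏ i ∈ s \ Finset.range n, u i - 1‖ ≤ ε / (2 * (M + 1)) := by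
    simpa using norm_prod_sub_prod_le (s \ Finset.range n) (a := u) (b := fun _ => 1)
      (M := fun _ => 1) hδ.le (fun i hi => hle i (hn0.trans (hmem i hi))) (by simp)
      (fun i hi => by simpa using hn i (hmem i hi))
  rw [dist_eq_norm, ← Finset.prod_sdiff hs, ← sub_one_mul, norm_mul]
  calc _ ≤ ε / (2 * (M + 1)) * M := by gcongr
    _ < ε := by
      rw [div_mul_eq_mul_div, div_lt_iff₀ (by positivity)]
      nlinarith

end Ultrametric

section EntireMap

variable {p : ℕ} [hp : Fact p.Prime] {K : Type*} [NormedField K]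
  {R : ℕ → ℝ} {c : ℕ → K}

/-- The polynomial truncations of `f_c`. -/
def fcPartial (p : ℕ) (c : ℕ → K) (n : ℕ) (z : K) : K :=
  z ^ p / (p : K) * ∏ i ∈ Finset.range n, (1 - z / c (i + 1))

lemma norm_div_succ (hc : InC p R c) (z : K) (i : ℕ) : ‖z / c (i + 1)‖ = ‖z‖ / R (i + 1) := by
  rw [norm_div, hc _ (Nat.le_add_left 1 i)]

lemma norm_one_sub_div_le [IsUltrametricDist K] (hR : IsRadii p R) (hc : InC p R c) {z : K} {r : ℝ}
    (hz : ‖z‖ ≤ r) (i : ℕ) : ‖1 - z / c (i + 1)‖ ≤ max 1 (r / R (i + 1)) := by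
  have := hR.pos (Nat.le_add_left 1 i)
  refine (norm_one_sub_le _).trans ?_
  rw [norm_div_succ hc]
  gcongr

lemma mem_Aset_iff {z : K} :
    z ∈ Aset R c ↔ 1 ≤ ‖z‖ ∧ ∀ j, 1 ≤ j → R j ≤ ‖z - c j‖ := by
  simp only [Aset, Set.mem_compl_iff, Set.mem_iUnion, not_exists, Bset]
  refine ⟨fun h => ⟨by simpa using h 0, fun j hj => by simpa [Nat.ne_of_gt hj] using h j⟩,
    fun h j => ?_⟩
  split_ifs with hj
  · simpa using h.1
  · simpa using h.2 j (Nat.one_le_iff_ne_zero.2 hj)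

lemma mem_Bset_iff {j : ℕ} (hj : 1 ≤ j) {z : K} : z ∈ Bset R c j ↔ ‖z - c j‖ < R j := by
  simp [Bset, Nat.ne_of_gt hj]

variable [IsUltrametricDist K] [CompleteSpace K]

lemma tendsto_fcPartial (hR : IsRadii p R) (hc : InC p R c) (z : K) :
    Tendsto (fun n => fcPartial p c n z) atTop (𝓝 (fc p c z)) := by
  refine Tendsto.const_mul _ (Multipliable.hasProd ?_).tendsto_prod_nat
  refine multipliable_of_tendsto_one ?_
  have h : Tendsto (fun i => z / c (i + 1)) atTop (𝓝 0) := by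
    rw [tendsto_zero_iff_norm_tendsto_zero]
    simp only [norm_div_succ hc]
    exact (hR.2.2.comp (tendsto_add_atTop_nat 1)).const_div_atTop ‖z‖
  simpa using h.const_sub 1

lemma norm_fc_of_forall_norm_eq (hpK : ‖(p : K)‖ = (p : ℝ)⁻¹) (hR : IsRadii p R) (hc : InC p R c)
    {z : K} (hz : ∀ i, ‖1 - z / c (i + 1)‖ = max 1 (‖z‖ / R (i + 1))) :
    ‖fc p c z‖ = phi p R ‖z‖ := by
  refine tendsto_nhds_unique (tendsto_fcPartial hR hc z).norm ?_
  refine tendsto_const_nhds.congr' ?_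
  filter_upwards [hR.eventually_phi_eq ‖z‖] with n hn
  rw [hn, fcPartial, norm_mul, norm_div, norm_pow, norm_prod, hpK, growthProd]
  simp only [hz]
  rw [div_inv_eq_mul, mul_comm (p : ℝ)]

lemma norm_fc_of_mem_Aset (hpK : ‖(p : K)‖ = (p : ℝ)⁻¹) (hR : IsRadii p R) (hc : InC p R c)
    {z : K} (hz : z ∈ Aset R c) : ‖fc p c z‖ = phi p R ‖z‖ := by
  refine norm_fc_of_forall_norm_eq hpK hR hc fun i => ?_
  have hpos := hR.pos (Nat.le_add_left 1 i)
  have hci := hc _ (Nat.le_add_left 1 i)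
  by_cases h : ‖z / c (i + 1)‖ = 1
  · refine le_antisymm (norm_one_sub_div_le hR hc le_rfl i) ?_
    rw [← norm_div_succ hc, h, max_self]
    have h0 : c (i + 1) ≠ 0 := norm_pos_iff.1 (hci ▸ hpos)
    rw [one_sub_div h0, norm_div, norm_sub_rev, hci, one_le_div hpos]
    exact (mem_Aset_iff.1 hz).2 _ (Nat.le_add_left 1 i)
  · rw [norm_one_sub_of_norm_ne_one h, norm_div_succ hc]

lemma norm_fc_of_norm_lt_one (hpK : ‖(p : K)‖ = (p : ℝ)⁻¹) (hR : IsRadii p R) (hc : InC p R c)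
    {z : K} (hz : ‖z‖ < 1) : ‖fc p c z‖ = p * ‖z‖ ^ p := by
  have h1 : (1 : ℝ) < p := by exact_mod_cast hp.1.one_lt
  have hz1 : ‖z‖ < R 1 := hz.trans (h1.trans hR.2.1)
  rw [norm_fc_of_forall_norm_eq hpK hR hc fun i => ?_, hR.phi_of_le hz1.le]
  rw [norm_one_sub_of_norm_ne_one, norm_div_succ hc]
  rw [norm_div_succ hc]
  refine ne_of_lt ?_
  rw [div_lt_one (hR.pos (Nat.le_add_left 1 i))]
  exact hz1.trans_le (hR.le le_rfl (Nat.le_add_left 1 i))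

lemma norm_fc_sub_fc_le (hpK : ‖(p : K)‖ = (p : ℝ)⁻¹) (hR : IsRadii p R) (hc : InC p R c)
    {z w : K} {r e : ℝ} (he : 0 ≤ e) (hz : ‖z‖ ≤ r) (hw : ‖w‖ ≤ r)
    (h : ‖z - w‖ ≤ r * e) : ‖fc p c z - fc p c w‖ ≤ phi p R r * e := by
  refine le_of_tendsto ((tendsto_fcPartial hR hc z).sub (tendsto_fcPartial hR hc w)).norm ?_
  filter_upwards [hR.eventually_phi_eq r] with n hn
  rw [hn, mul_comm (p : ℝ)]
  have hp0 : (0 : ℝ) < p := by exact_mod_cast hp.1.pos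
  refine norm_mul_sub_mul_le ?_ ?_ ?_ ?_
  · rw [norm_div, norm_pow, hpK, div_inv_eq_mul]
    gcongr
  · rw [norm_prod]
    exact Finset.prod_le_prod (fun _ _ => norm_nonneg _)
      fun i _ => norm_one_sub_div_le hR hc hz i
  · rw [← sub_div, norm_div, hpK, div_inv_eq_mul, mul_right_comm]
    gcongr
    exact norm_pow_sub_pow_le he hz hw h p
  · refine norm_prod_sub_prod_le _ he (fun i _ => norm_one_sub_div_le hR hc hz i)
      (fun i _ => norm_one_sub_div_le hR hc hw i) fun i _ => ?_
    have hpos := hR.pos (Nat.le_add_left 1 i)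
    rw [sub_sub_sub_cancel_left, ← sub_div, norm_div_succ hc, norm_sub_rev]
    calc ‖z - w‖ / R (i + 1) ≤ r * e / R (i + 1) := by gcongr
      _ = r / R (i + 1) * e := by ring
      _ ≤ _ := by
        gcongr
        exact le_max_right _ _

lemma norm_fc_sub_fc_le_of_lt_one (hpK : ‖(p : K)‖ = (p : ℝ)⁻¹) (hR : IsRadii p R)
    (hc : InC p R c) {z w : K} {t e : ℝ} (ht : t < 1) (he : 0 ≤ e) (he1 : e ≤ 1) (hz : ‖z‖ ≤ t)
    (hw : ‖w‖ ≤ t) (h : ‖z - w‖ ≤ t * e) :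
    ‖fc p c z - fc p c w‖ ≤ p * t ^ p * max (e ^ p) (e / p) := by
  have h1 : (1 : ℝ) < p := by exact_mod_cast hp.1.one_lt
  have hone : ∀ (x : K), ‖x‖ ≤ t → ∀ i, ‖1 - x / c (i + 1)‖ ≤ 1 := fun x hx i => by
    refine (norm_one_sub_div_le hR hc hx i).trans (max_le le_rfl ?_)
    rw [div_le_one (hR.pos (Nat.le_add_left 1 i))]
    linarith [hR.prime_lt (Nat.le_add_left 1 i)]
  have hD : 0 ≤ max (e ^ p) (e / p) := le_max_of_le_left (by positivity)
  refine le_of_tendsto' ((tendsto_fcPartial hR hc z).sub (tendsto_fcPartial hR hc w)).norm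
    fun n => ?_
  rw [← mul_one (p * t ^ p)]
  refine norm_mul_sub_mul_le ?_ ?_ ?_ ?_
  · rw [norm_div, norm_pow, hpK, div_inv_eq_mul, mul_comm]
    gcongr
  · rw [norm_prod]
    exact Finset.prod_le_one (fun _ _ => norm_nonneg _) fun i _ => hone z hz i
  · rw [← sub_div, norm_div, hpK, div_inv_eq_mul, mul_comm, mul_assoc]
    gcongr
    exact norm_pow_prime_sub_pow_prime_le hp.1 hpK he he1 hw h
  · have := norm_prod_sub_prod_le (Finset.range n) (M := fun _ => (1 : ℝ)) hD
      (fun i _ => hone z hz i) (fun i _ => hone w hw i) fun i _ => ?_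
    · simpa using this
    have hlt := hR.prime_lt (Nat.le_add_left 1 i)
    rw [sub_sub_sub_cancel_left, ← sub_div, norm_div_succ hc, norm_sub_rev, one_mul]
    refine le_max_of_le_right ?_
    have : ‖z - w‖ ≤ e := h.trans (mul_le_of_le_one_left he ht.le)
    gcongr

lemma norm_fc_sub_fc_of_param (hR : IsRadii p R) {c' : ℕ → K} (hc : InC p R c)
    (hc' : InC p R c') {k : ℕ} (hk : 1 ≤ k) (hcc : ∀ j, 1 ≤ j → j ≠ k → c' j = c j) {z : K}
    (hz : ‖z‖ < R k) :
    ‖fc p c' z - fc p c z‖ = ‖fc p c z‖ * (‖z‖ * (‖c' k - c k‖ / R k ^ 2)) := by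
  obtain ⟨k, rfl⟩ : ∃ j, k = j + 1 := ⟨k - 1, by omega⟩
  have hpos := hR.pos hk
  have hck : c (k + 1) ≠ 0 := norm_pos_iff.1 (hc _ hk ▸ hpos)
  have hck' : c' (k + 1) ≠ 0 := norm_pos_iff.1 (hc' _ hk ▸ hpos)
  have hcross : fc p c' z * (1 - z / c (k + 1)) = fc p c z * (1 - z / c' (k + 1)) := by
    refine tendsto_nhds_unique ((tendsto_fcPartial hR hc' z).mul_const _)
      (Tendsto.congr' ?_ ((tendsto_fcPartial hR hc z).mul_const _))
    filter_upwards [eventually_gt_atTop k] with n hn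
    have hmem := Finset.mem_range.2 hn
    have herase : ∏ i ∈ (Finset.range n).erase k, (1 - z / c' (i + 1)) =
        ∏ i ∈ (Finset.range n).erase k, (1 - z / c (i + 1)) :=
      Finset.prod_congr rfl fun i hi => by
        rw [hcc (i + 1) (Nat.le_add_left 1 i) (by simpa using Finset.ne_of_mem_erase hi)]
    rw [fcPartial, fcPartial, ← Finset.mul_prod_erase _ _ hmem, ← Finset.mul_prod_erase _ _ hmem,
      herase]
    ring
  have hone : ‖1 - z / c (k + 1)‖ = 1 := by
    have hlt : ‖z‖ / R (k + 1) < 1 := (div_lt_one hpos).2 hz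
    rw [norm_one_sub_of_norm_ne_one (by rw [norm_div_succ hc]; exact hlt.ne), norm_div_succ hc,
      max_eq_left hlt.le]
  rw [← mul_one ‖fc p c' z - fc p c z‖, ← hone, ← norm_mul, sub_mul, hcross, ← mul_sub,
    sub_sub_sub_cancel_left, norm_mul, div_sub_div _ _ hck hck', norm_div, norm_mul, hc _ hk,
    hc' _ hk, ← pow_two, mul_comm (c (k + 1)) z, ← mul_sub, norm_mul, mul_div_assoc]

end EntireMap

section Excursion

variable {K : Type*} [NormedField K]

/-- The points `x 0, …, x (m + n)` of an orbit of `f_c` follow the word `B_0^m A^n` and then reach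
the sphere of radius `R_j`. -/
structure IsExcursion (p : ℕ) (R : ℕ → ℝ) (c : ℕ → K) (x : ℕ → K) (m n j : ℕ) : Prop where
  orbit : ∀ i, x (i + 1) = fc p c (x i)
  one_le : 1 ≤ n
  inner : ∀ s < m, ‖x s‖ < 1
  outer : ∀ s < n, x (m + s) ∈ Aset R c
  last : ‖x (m + n)‖ = R j

lemma IsExcursion.one_le_norm {p : ℕ} {R : ℕ → ℝ} {c x : ℕ → K} {m n j : ℕ}
    (hx : IsExcursion p R c x m n j) {s : ℕ} (hs : s < n) : 1 ≤ ‖x (m + s)‖ :=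
  (mem_Aset_iff.1 (hx.outer s hs)).1

end Excursion

section Perturbation

variable {p : ℕ} [hp : Fact p.Prime] {K : Type*} [NormedField K]
  {R : ℕ → ℝ} {c c' : ℕ → K}

/-- `c` and `c'` are parameters differing only in the index `k`, where the relative effect of the
difference on the maps is bounded by `η`. -/
structure IsPerturbation (p : ℕ) [Fact p.Prime] (R : ℕ → ℝ) (c c' : ℕ → K) (k : ℕ) (η : ℝ) :
    Prop where
  norm_prime : ‖(p : K)‖ = (p : ℝ)⁻¹
  radii : IsRadii p R
  left : InC p R c
  right : InC p R c'
  one_le : 1 ≤ k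
  eq_of_ne : ∀ j, 1 ≤ j → j ≠ k → c' j = c j
  le : ‖c' k - c k‖ / R k ^ 2 ≤ η
  mul_lt : R k * η < 1

variable {k : ℕ} {η : ℝ}

lemma IsPerturbation.nonneg (h : IsPerturbation p R c c' k η) : 0 ≤ η :=
  (by positivity : (0 : ℝ) ≤ ‖c' k - c k‖ / R k ^ 2).trans h.le

lemma IsPerturbation.mul_lt_one (h : IsPerturbation p R c c' k η) {t : ℝ} (ht : t < R k) :
    t * η < 1 :=
  (mul_le_mul_of_nonneg_right ht.le h.nonneg).trans_lt h.mul_lt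

lemma IsPerturbation.le_rho (h : IsPerturbation p R c c' k η) : η ≤ rho p := by
  have hp0 : (0 : ℝ) < p := by exact_mod_cast hp.1.pos
  refine le_trans ?_ (inv_le_rho p)
  rw [← one_div, le_div_iff₀' hp0]
  exact (h.mul_lt_one (h.radii.prime_lt h.one_le)).le

variable [IsUltrametricDist K] [CompleteSpace K]

lemma IsPerturbation.norm_sub_le (h : IsPerturbation p R c c' k η) {x y : K} {B : ℝ}
    (hx : ‖x‖ < R k) (hxy : ‖fc p c' y - fc p c' x‖ ≤ B) :
    ‖fc p c' y - fc p c x‖ ≤ max B (‖fc p c x‖ * (‖x‖ * η)) := by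
  rw [← sub_add_sub_cancel _ (fc p c' x)]
  refine (IsUltrametricDist.norm_add_le_max _ _).trans (max_le_max hxy ?_)
  rw [norm_fc_sub_fc_of_param h.radii h.left h.right h.one_le h.eq_of_ne hx]
  gcongr
  exact h.le

lemma IsPerturbation.norm_sub_le_of_norm_le (h : IsPerturbation p R c c' k η) {x y : K} {r e : ℝ}
    (hr : r < R k) (he : 0 ≤ e) (hx : ‖x‖ ≤ r) (hy : ‖y‖ ≤ r) (hxy : ‖y - x‖ ≤ r * e) :
    ‖fc p c' y - fc p c x‖ ≤ max (phi p R r * e) (‖fc p c x‖ * (‖x‖ * η)) :=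
  h.norm_sub_le (hx.trans_lt hr) (norm_fc_sub_fc_le h.norm_prime h.radii h.right he hy hx hxy)

lemma IsPerturbation.norm_sub_le_of_norm_lt_one (h : IsPerturbation p R c c' k η) {x y : K}
    {e : ℝ} (he : 0 ≤ e) (he1 : e ≤ 1) (hx : ‖x‖ < 1) (hxy : ‖y - x‖ ≤ ‖x‖ * e) :
    ‖fc p c' y - fc p c x‖ ≤ ‖fc p c x‖ * max (max (e ^ p) (e / p)) (‖x‖ * η) := by
  have h1 : (1 : ℝ) < p := by exact_mod_cast hp.1.one_lt
  have hy : ‖y‖ ≤ ‖x‖ :=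
    norm_le_of_norm_sub_le le_rfl (hxy.trans (mul_le_of_le_one_right (norm_nonneg x) he1))
  rw [mul_max_of_nonneg _ (‖x‖ * η) (norm_nonneg _)]
  refine h.norm_sub_le (hx.trans (h1.trans (h.radii.prime_lt h.one_le))) ?_
  rw [norm_fc_of_norm_lt_one h.norm_prime h.radii h.left hx]
  exact norm_fc_sub_fc_le_of_lt_one h.norm_prime h.radii h.right hx he he1 hy le_rfl hxy

lemma IsPerturbation.norm_sub_le_of_mem_Aset (h : IsPerturbation p R c c' k η) {x y : K}
    {e : ℝ} (he : 0 ≤ e) (he1 : e ≤ 1) (hx : x ∈ Aset R c) (hxk : ‖x‖ < R k)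
    (hxy : ‖y - x‖ ≤ ‖x‖ * e) :
    ‖fc p c' y - fc p c x‖ ≤ ‖fc p c x‖ * max e (‖x‖ * η) := by
  have hy : ‖y‖ ≤ ‖x‖ :=
    norm_le_of_norm_sub_le le_rfl (hxy.trans (mul_le_of_le_one_right (norm_nonneg x) he1))
  rw [mul_max_of_nonneg _ _ (norm_nonneg _)]
  refine (h.norm_sub_le_of_norm_le hxk he le_rfl hy hxy).trans ?_
  rw [norm_fc_of_mem_Aset h.norm_prime h.radii h.left hx]

variable {x y : ℕ → K} {m n j : ℕ}

lemma IsExcursion.rho_lt_norm (h : IsPerturbation p R c c' k η)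
    (hx : IsExcursion p R c x m n j) {s : ℕ} (hs : s ≤ m) : rho p < ‖x s‖ := by
  by_contra! hle
  have key : ∀ t, s + t ≤ m → ‖x (s + t)‖ ≤ rho p := by
    intro t
    induction t with
    | zero => exact fun _ => hle
    | succ t ih =>
      intro ht
      rw [← add_assoc, hx.orbit, norm_fc_of_norm_lt_one h.norm_prime h.radii h.left
        (hx.inner _ (by omega))]
      conv_rhs => rw [← mul_rho_pow p]
      have := ih (by omega)
      gcongr
  have h1 := key (m - s) (by omega)
  rw [Nat.add_sub_cancel' hs] at h1
  exact absurd ((hx.one_le_norm hx.one_le).trans h1) (rho_lt_one p).not_ge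

lemma IsExcursion.norm_succ (h : IsPerturbation p R c c' k η) (hx : IsExcursion p R c x m n j)
    {s : ℕ} (hs : s < n) : ‖x (m + (s + 1))‖ = phi p R ‖x (m + s)‖ := by
  rw [← add_assoc, hx.orbit, norm_fc_of_mem_Aset h.norm_prime h.radii h.left (hx.outer s hs)]

lemma IsExcursion.norm_le_norm (h : IsPerturbation p R c c' k η)
    (hx : IsExcursion p R c x m n j) {s t : ℕ} (hst : s ≤ t) (ht : t ≤ n) :
    ‖x (m + s)‖ ≤ ‖x (m + t)‖ := by
  induction t, hst using Nat.le_induction with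
  | base => exact le_rfl
  | succ t hst ih =>
    refine (ih (by omega)).trans ?_
    rw [hx.norm_succ h (by omega)]
    exact (h.radii.lt_phi (hx.one_le_norm (by omega))).le

lemma IsExcursion.norm_lt_radius (h : IsPerturbation p R c c' k η)
    (hx : IsExcursion p R c x m n j) {s : ℕ} (hs : s < n) : ‖x (m + s)‖ < R j := by
  rw [← hx.last]
  refine lt_of_lt_of_le ?_ (hx.norm_le_norm h (Nat.succ_le_of_lt hs) le_rfl)
  rw [hx.norm_succ h hs]
  exact h.radii.lt_phi (hx.one_le_norm hs)

lemma IsExcursion.phi_iterate_norm (h : IsPerturbation p R c c' k η)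
    (hx : IsExcursion p R c x m n j) {s t : ℕ} (hst : s + t = n) :
    (phi p R)^[t] ‖x (m + s)‖ = R j := by
  induction t generalizing s with
  | zero => rw [Function.iterate_zero_apply, ← hx.last, ← hst, add_zero]
  | succ t ih =>
    rw [Function.iterate_succ_apply, ← hx.norm_succ h (by omega)]
    exact ih (by omega)

lemma IsExcursion.norm_ne_radius (h : IsPerturbation p R c c' k η) (hR : IsGenericRadii p R)
    (hx : IsExcursion p R c x m n j) (hj : 1 ≤ j) {s i : ℕ} (hs : s < n) (hi : 1 ≤ i) :
    ‖x (m + s)‖ ≠ R i := by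
  intro heq
  have hlt := heq ▸ hx.norm_lt_radius h hs
  have hij : i < j := by
    by_contra! hji
    exact absurd (h.radii.le hj hji) hlt.not_ge
  refine hR.2 i j (n - s) hi hij (by omega) ?_
  rw [← heq]
  exact hx.phi_iterate_norm h (by omega)

lemma IsExcursion.norm_sub_lt (h : IsPerturbation p R c c' k η)
    (hx : IsExcursion p R c x m n j) (hj : 1 ≤ j) (hjk : j < k)
    (hy : ∀ i, y (i + 1) = fc p c' (y i)) (h0 : ‖y 0 - x 0‖ < rho p) {s : ℕ} (hs : s ≤ m + n) :
    ‖y s - x s‖ < ‖x s‖ := by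
  have h1 : (1 : ℝ) < p := by exact_mod_cast hp.1.one_lt
  have hjk' := h.radii.lt hj hjk
  induction s with
  | zero => exact h0.trans (hx.rho_lt_norm h (Nat.zero_le _))
  | succ s ih =>
    have hlt := ih (by omega)
    have hpos : 0 < ‖x s‖ := (norm_nonneg _).trans_lt hlt
    have he : 0 ≤ ‖y s - x s‖ / ‖x s‖ := by positivity
    have he1 : ‖y s - x s‖ / ‖x s‖ < 1 := (div_lt_one hpos).2 hlt
    have hle : ‖y s - x s‖ ≤ ‖x s‖ * (‖y s - x s‖ / ‖x s‖) := (mul_div_cancel₀ _ hpos.ne').ge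
    rcases lt_or_ge s m with hsm | hsm
    · have hstep := h.norm_sub_le_of_norm_lt_one he he1.le (hx.inner s hsm) hle
      rw [← hx.orbit, ← hy] at hstep
      refine hstep.trans_lt (mul_lt_of_lt_one_right ?_ (max_lt (max_lt ?_ ?_) ?_))
      · exact (rho_pos p).trans (hx.rho_lt_norm h hsm)
      · exact pow_lt_one₀ he he1 hp.1.ne_zero
      · exact (div_le_self he h1.le).trans_lt he1
      · exact h.mul_lt_one ((hx.inner s hsm).trans (h1.trans (h.radii.prime_lt h.one_le)))
    · obtain ⟨s, rfl⟩ := Nat.exists_eq_add_of_le hsm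
      have hlt := hx.norm_lt_radius h (show s < n by omega)
      have hstep := h.norm_sub_le_of_mem_Aset he he1.le (hx.outer s (by omega))
        (hlt.trans hjk') hle
      rw [← hx.orbit, ← hy] at hstep
      refine hstep.trans_lt (mul_lt_of_lt_one_right ?_ (max_lt he1 ?_))
      · exact hpos.trans_le (hx.norm_le_norm h (Nat.le_succ s) (by omega))
      · exact h.mul_lt_one (hlt.trans hjk')

lemma IsExcursion.norm_sub_le_inner (h : IsPerturbation p R c c' k η)
    (hx : IsExcursion p R c x m n j) (hy : ∀ i, y (i + 1) = fc p c' (y i)) {E : ℝ} (hE : E ≤ rho p)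
    (h0 : ‖y 0 - x 0‖ ≤ rho p * E) {s : ℕ} (hs : s ≤ m) :
    ‖y s - x s‖ ≤ ‖x s‖ * max (E / p ^ s) η := by
  have h1 : (1 : ℝ) < p := by exact_mod_cast hp.1.one_lt
  have hη := h.nonneg
  have hE0 : 0 ≤ E := nonneg_of_mul_nonneg_right ((norm_nonneg _).trans h0) (rho_pos p)
  induction s with
  | zero =>
    refine h0.trans ?_
    rw [pow_zero, div_one]
    exact mul_le_mul (hx.rho_lt_norm h (Nat.zero_le _)).le (le_max_left _ _) hE0 (norm_nonneg _)
  | succ s ih =>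
    have hsm : s < m := by omega
    have he : 0 ≤ max (E / p ^ s) η := le_max_of_le_right hη
    have heρ : max (E / p ^ s) η ≤ rho p :=
      max_le ((div_le_self hE0 (one_le_pow₀ h1.le)).trans hE) h.le_rho
    have hstep := h.norm_sub_le_of_norm_lt_one he (heρ.trans (rho_lt_one p).le) (hx.inner s hsm)
      (ih hsm.le)
    rw [← hx.orbit, ← hy] at hstep
    refine hstep.trans (mul_le_mul_of_nonneg_left ?_ (norm_nonneg _))
    rw [max_eq_right (pow_le_div_of_le_rho p he heρ)]
    refine max_le ?_ (le_max_of_le_right (mul_le_of_le_one_left hη (hx.inner s hsm).le))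
    rw [← max_div_div_right (by positivity : (0:ℝ) ≤ p), div_div, ← pow_succ]
    exact max_le_max le_rfl (div_le_self hη h1.le)

lemma IsExcursion.norm_sub_le_last (h : IsPerturbation p R c c' k η)
    (hx : IsExcursion p R c x m n j) (hj : 1 ≤ j) (hjk : j < k)
    (hy : ∀ i, y (i + 1) = fc p c' (y i)) (h0 : ‖y 0 - x 0‖ ≤ rho p ^ 2)
    (h0' : ‖y 0 - x 0‖ ≤ rho p ^ 2 * p ^ m * η) :
    ‖y (m + n) - x (m + n)‖ ≤ R j * (‖x (m + (n - 1))‖ * η) := by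
  have hp0 : (0 : ℝ) < p := by exact_mod_cast hp.1.pos
  have hρ := rho_pos p
  have hη := h.nonneg
  have hn := hx.one_le
  have hjk' := h.radii.lt hj hjk
  have hS : 1 ≤ ‖x (m + (n - 1))‖ := hx.one_le_norm (by omega)
  have hSη : η ≤ ‖x (m + (n - 1))‖ * η := le_mul_of_one_le_left hη hS
  have hSη1 : ‖x (m + (n - 1))‖ * η ≤ 1 :=
    (h.mul_lt_one ((hx.norm_lt_radius h (by omega)).trans hjk')).le
  have hinner : ‖y m - x m‖ ≤ ‖x m‖ * η := by
    have := hx.norm_sub_le_inner h hy (E := ‖y 0 - x 0‖ / rho p)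
      (by rwa [div_le_iff₀ hρ, ← pow_two]) (mul_div_cancel₀ _ hρ.ne').ge le_rfl
    rwa [max_eq_right] at this
    rw [div_div, div_le_iff₀ (by positivity)]
    refine h0'.trans ?_
    calc rho p ^ 2 * p ^ m * η = rho p * (η * (rho p * p ^ m)) := by ring
      _ ≤ η * (rho p * p ^ m) := mul_le_of_le_one_left (by positivity) (rho_lt_one p).le
  have houter : ∀ s ≤ n, ‖y (m + s) - x (m + s)‖ ≤ ‖x (m + s)‖ * (‖x (m + (n - 1))‖ * η) := by
    intro s
    induction s with
    | zero => exact fun _ => hinner.trans (mul_le_mul_of_nonneg_left hSη (norm_nonneg _))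
    | succ s ih =>
      intro hs
      have hstep := h.norm_sub_le_of_mem_Aset (by positivity) hSη1 (hx.outer s (by omega))
        ((hx.norm_lt_radius h (by omega)).trans hjk') (ih (by omega))
      rw [← hx.orbit, ← hy] at hstep
      refine hstep.trans (mul_le_mul_of_nonneg_left (max_le le_rfl ?_) (norm_nonneg _))
      exact mul_le_mul_of_nonneg_right (hx.norm_le_norm h (by omega) (by omega)) hη
  simpa only [hx.last] using houter n le_rfl

lemma IsPerturbation.norm_sub_le_of_mem_Bset (h : IsPerturbation p R c c' k η)
    (hj : 1 ≤ j) (hjk : j < k) {l : ℕ} (hx : ∀ i, x (i + 1) = fc p c (x i))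
    (hy : ∀ i, y (i + 1) = fc p c' (y i)) (hxl : ∀ s ≤ l, ‖x s‖ ≤ R j) {S : ℝ}
    (hS : R j ≤ lam p R j * S) (h0 : ‖y 0 - x 0‖ ≤ R j * (S * η))
    (hl : lam p R j ^ l * (S * η) ≤ 1) {s : ℕ} (hs : s ≤ l) :
    ‖y s - x s‖ ≤ R j * (lam p R j ^ s * (S * η)) := by
  have h1 : (1 : ℝ) < p := by exact_mod_cast hp.1.one_lt
  have hη := h.nonneg
  have hRj := h.radii.pos hj
  have hRj1 : 1 ≤ R j := (h1.trans (h.radii.prime_lt hj)).le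
  have hlam : 1 ≤ lam p R j := (one_le_div hRj).2 (h.radii.lt_phi hRj1).le
  have hlam0 := zero_le_one.trans hlam
  have hS0 : 0 ≤ S := by
    by_contra! hneg
    nlinarith
  induction s with
  | zero => simpa using h0
  | succ s ih =>
    have hd := ih (by omega)
    have he1 : lam p R j ^ s * (S * η) ≤ 1 :=
      (mul_le_mul_of_nonneg_right (pow_le_pow_right₀ hlam (by omega)) (by positivity)).trans hl
    have hyR : ‖y s‖ ≤ R j := norm_le_of_norm_sub_le (hxl s (by omega))
      (hd.trans (mul_le_of_le_one_right hRj.le he1))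
    have hstep := h.norm_sub_le_of_norm_le (h.radii.lt hj hjk) (by positivity)
      (hxl s (by omega)) hyR hd
    rw [← hx, ← hy] at hstep
    refine hstep.trans (max_le (le_of_eq ?_) ?_)
    · rw [lam, pow_succ]
      field_simp
    · calc ‖x (s + 1)‖ * (‖x s‖ * η) ≤ R j * (R j * η) := by
            have := hxl s (by omega)
            have := hxl (s + 1) hs
            gcongr
        _ ≤ R j * (lam p R j * S * η) := by gcongr
        _ ≤ R j * (lam p R j ^ (s + 1) * (S * η)) := by
          rw [← mul_assoc (lam p R j ^ (s + 1))]
          gcongr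
          exact le_self_pow₀ hlam (Nat.succ_ne_zero s)

end Perturbation

section Itinerary

variable {m n l : ℕ → ℕ}

lemma Lseq_succ {j : ℕ} (hj : 1 ≤ j) :
    Lseq m n l (j + 1) = Lseq m n l j + m j + n j + l (j + 1) := by
  obtain ⟨j, rfl⟩ : ∃ i, j = i + 1 := ⟨j - 1, by omega⟩
  rfl

lemma Lseq_lt (hm : ∀ j, 1 ≤ j → 1 ≤ m j) {i j : ℕ} (hi : 1 ≤ i) (hij : i < j) :
    Lseq m n l i < Lseq m n l j := by
  induction j, hij using Nat.le_induction with
  | base =>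
    have := hm i hi
    rw [Lseq_succ hi]
    omega
  | succ j hij ih =>
    have := hm j (by omega)
    rw [Lseq_succ (by omega)]
    omega

lemma Lseq_le (hm : ∀ j, 1 ≤ j → 1 ≤ m j) {i j : ℕ} (hi : 1 ≤ i) (hij : i ≤ j) :
    Lseq m n l i ≤ Lseq m n l j := by
  rcases hij.eq_or_lt with rfl | h
  · exact le_rfl
  · exact (Lseq_lt hm hi h).le

lemma itin_eq (hm : ∀ j, 1 ≤ j → 1 ≤ m j) {i j : ℕ} (hj : 1 ≤ j) (hi : Lseq m n l j ≤ i)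
    (hi' : i < Lseq m n l (j + 1)) :
    itin m n l i = if i < Lseq m n l j + m j then some 0
      else if i < Lseq m n l j + m j + n j then none else some j := by
  have hsup : sSup {k : ℕ | 1 ≤ k ∧ Lseq m n l k ≤ i} = j := by
    refine IsGreatest.csSup_eq ⟨⟨hj, hi⟩, fun q hq => ?_⟩
    by_contra! hlt
    have := Lseq_le (n := n) (l := l) hm (Nat.le_add_left 1 j) (Nat.succ_le_of_lt hlt)
    have := hq.2
    omega
  rw [itin, hsup]

lemma exists_Lseq_le_lt {k i : ℕ} (hk : 1 ≤ k)
    (hi : i < Lseq m n l (k + 1)) :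
    ∃ j, 1 ≤ j ∧ j ≤ k ∧ Lseq m n l j ≤ i ∧ i < Lseq m n l (j + 1) := by
  induction k, hk using Nat.le_induction with
  | base => exact ⟨1, le_rfl, le_rfl, Nat.zero_le _, hi⟩
  | succ k hk ih =>
    rcases lt_or_ge i (Lseq m n l (k + 1)) with h | h
    · obtain ⟨j, h1, h2, h3⟩ := ih h
      exact ⟨j, h1, by omega, h3⟩
    · exact ⟨k + 1, by omega, le_rfl, h, hi⟩

lemma forall_itin_iff (hm : ∀ j, 1 ≤ j → 1 ≤ m j) (hl : ∀ j, 2 ≤ j → 1 ≤ l j) {k : ℕ}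
    (hk : 1 ≤ k) (P : ℕ → Option ℕ → Prop) :
    (∀ i ≤ Nseq m n l k, P i (itin m n l i)) ↔
      ∀ j, 1 ≤ j → j ≤ k →
        (∀ s < m j, P (Lseq m n l j + s) (some 0)) ∧
        (∀ s < n j, P (Lseq m n l j + (m j + s)) none) ∧
        P (Lseq m n l j + (m j + n j)) (some j) ∧
        (j < k → ∀ s < l (j + 1), P (Lseq m n l j + (m j + n j + s)) (some j)) := by
  constructor
  · intro h j hj hjk
    have hlj := hl (j + 1) (by omega)
    have hsucc := Lseq_succ (m := m) (n := n) (l := l) hj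
    have hle := Lseq_le (n := n) (l := l) hm hj hjk
    have hNj : Lseq m n l j + (m j + n j) ≤ Nseq m n l k := by
      rcases hjk.eq_or_lt with rfl | hlt
      · rw [Nseq, add_assoc]
      · have := Lseq_le (n := n) (l := l) hm (Nat.le_add_left 1 j) (Nat.succ_le_of_lt hlt)
        rw [Nseq]
        omega
    have hitin : ∀ s, s < m j + n j + l (j + 1) → itin m n l (Lseq m n l j + s) =
        if s < m j then some 0 else if s < m j + n j then none else some j := fun s hs => by
      rw [itin_eq hm hj (by omega) (by omega)]
      simp only [add_assoc, add_lt_add_iff_left]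
    refine ⟨fun s hs => ?_, fun s hs => ?_, ?_, fun hlt s hs => ?_⟩
    · have := h (Lseq m n l j + s) (by omega)
      rwa [hitin s (by omega), if_pos hs] at this
    · have := h (Lseq m n l j + (m j + s)) (by omega)
      rwa [hitin _ (by omega), if_neg (by omega), if_pos (by omega)] at this
    · have := h (Lseq m n l j + (m j + n j)) hNj
      rwa [hitin _ (by omega), if_neg (by omega), if_neg (by omega)] at this
    · have hle' := Lseq_le (n := n) (l := l) hm (Nat.le_add_left 1 j) (Nat.succ_le_of_lt hlt)
      have := h (Lseq m n l j + (m j + n j + s)) (by rw [Nseq]; omega)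
      rwa [hitin _ (by omega), if_neg (by omega), if_neg (by omega)] at this
  · intro h i hi
    have hlt : i < Lseq m n l (k + 1) := by
      have := hl (k + 1) (by omega)
      rw [Lseq_succ hk]
      rw [Nseq] at hi
      omega
    obtain ⟨j, hj, hjk, hji, hij⟩ := exists_Lseq_le_lt hk hlt
    obtain ⟨h1, h2, h3, h4⟩ := h j hj hjk
    obtain ⟨s, rfl⟩ := Nat.exists_eq_add_of_le hji
    rw [itin_eq hm hj hji hij]
    rw [Lseq_succ hj] at hij
    split_ifs with ha hb
    · exact h1 s (by omega)
    · obtain ⟨t, rfl⟩ := Nat.exists_eq_add_of_le (show m j ≤ s by omega)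
      exact h2 t (by omega)
    · obtain ⟨t, rfl⟩ := Nat.exists_eq_add_of_le (show m j + n j ≤ s by omega)
      rcases hjk.eq_or_lt with rfl | hlt
      · obtain rfl : t = 0 := by
          rw [Nseq] at hi
          omega
        exact h3
      · exact h4 hlt t (by omega)

end Itinerary

section Stability

variable {p : ℕ} [hp : Fact p.Prime] {K : Type*} [NormedField K] [IsUltrametricDist K]
  [CompleteSpace K] {R : ℕ → ℝ} {c c' : ℕ → K} {k : ℕ} {ε : ℕ → ℝ} {m l : ℕ → ℕ}

lemma IsExcursion.Sse_eq {j k m n : ℕ} {η : ℝ} {x : ℕ → K} (h : IsPerturbation p R c c' k η)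
    (hx : IsExcursion p R c x m n j) (hS : 0 < Sse p R j) :
    Sse p R j = ‖x (m + (n - 1))‖ := by
  have hn := hx.one_le
  have hphi : phi p R ‖x (m + (n - 1))‖ = R j :=
    hx.phi_iterate_norm h (t := 1) (Nat.sub_add_cancel hn)
  have hphi' : phi p R (Sse p R j) = R j := Function.invFun_eq ⟨_, hphi⟩
  have hpos : 0 < ‖x (m + (n - 1))‖ := zero_lt_one.trans_le (hx.one_le_norm (by omega))
  rcases lt_trichotomy (Sse p R j) ‖x (m + (n - 1))‖ with hlt | heq | hgt
  · exact absurd (h.radii.phi_strictMono hS hlt) (by rw [hphi, hphi']; exact lt_irrefl _)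
  · exact heq
  · exact absurd (h.radii.phi_strictMono hpos hgt) (by rw [hphi, hphi']; exact lt_irrefl _)

lemma Cond33.Sse_pos (h33 : Cond33 p R ε l (k + 1)) (hR : IsRadii p R) (hε : 0 < ε (k + 1))
    {j : ℕ} (hj : 1 ≤ j) (hjk : j < k) : 0 < Sse p R j := by
  by_contra! hS
  have h := hε.trans (h33 (j + 1) (by omega) (by omega))
  rw [Nat.add_sub_cancel] at h
  have h1 : (1 : ℝ) < p := by exact_mod_cast hp.1.one_lt
  have hRj := hR.pos hj
  have hlam : 0 < lam p R j :=
    div_pos (hRj.trans (hR.lt_phi (h1.trans (hR.prime_lt hj)).le)) hRj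
  refine absurd h (not_lt.2 (mul_nonpos_of_nonpos_of_nonneg ?_ (by positivity)))
  have := rho_pos p
  exact mul_nonpos_of_nonneg_of_nonpos (by positivity)
    (inv_nonpos.2 (mul_nonpos_of_nonneg_of_nonpos hRj.le hS))

lemma IsPerturbation.norm_orbit_sub_lt
    (h : IsPerturbation p R c c' (k + 1) (ε (k + 1) / R (k + 1) ^ 2))
    (hε : 0 < ε (k + 1)) (h33 : Cond33 p R ε l (k + 1)) (h34 : Cond34 p R m l k)
    {x y : ℕ → K} {L : ℕ → ℕ} {n : ℕ → ℕ} (hx : ∀ i, x (i + 1) = fc p c (x i))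
    (hy : ∀ i, y (i + 1) = fc p c' (y i)) (hL1 : y (L 1) = x (L 1))
    (hL : ∀ j, 1 ≤ j → L (j + 1) = L j + (m j + n j + l (j + 1)))
    (hexc : ∀ j, 1 ≤ j → j ≤ k → IsExcursion p R c (fun i => x (L j + i)) (m j) (n j) j)
    (hB : ∀ j, 1 ≤ j → j < k → ∀ s ≤ l (j + 1), ‖x (L j + (m j + n j + s))‖ ≤ R j)
    {j : ℕ} (hj : 1 ≤ j) (hjk : j ≤ k) :
    ‖y (L j) - x (L j)‖ < rho p ^ (k + 1 - j) ∧
    ‖y (L j) - x (L j)‖ ≤ rho p ^ 2 * p ^ m j * (ε (k + 1) / R (k + 1) ^ 2) ∧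
    (j < k → ∀ s ≤ l (j + 1),
      ‖y (L j + (m j + n j + s)) - x (L j + (m j + n j + s))‖ < R j) := by
  have hρ := rho_pos p
  have hp1 : (1 : ℝ) < p := by exact_mod_cast hp.1.one_lt
  have hη := h.nonneg
  have hRk := h.radii.pos h.one_le
  set η := ε (k + 1) / R (k + 1) ^ 2 with hηdef
  have tail : ∀ j, 1 ≤ j → j < k → ‖y (L j) - x (L j)‖ < rho p ^ (k + 1 - j) →
      ‖y (L j) - x (L j)‖ ≤ rho p ^ 2 * p ^ m j * η →
      R j * (lam p R j ^ l (j + 1) * (Sse p R j * η)) < rho p ^ (k + 1 - (j + 1)) ∧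
      ∀ s ≤ l (j + 1), ‖y (L j + (m j + n j + s)) - x (L j + (m j + n j + s))‖ ≤
        R j * (lam p R j ^ s * (Sse p R j * η)) := by
    intro j hj hjk hd hd'
    have hRj := h.radii.pos hj
    have hRj1 : 1 < R j := hp1.trans (h.radii.prime_lt hj)
    have hS := h33.Sse_pos h.radii hε hj hjk
    have hlam : 0 < lam p R j := div_pos (hRj.trans (h.radii.lt_phi hRj1.le)) hRj
    have he := hexc j hj hjk.le
    have hSeq := he.Sse_eq h hS
    have hn := he.one_le
    have hbound : R j * (lam p R j ^ l (j + 1) * (Sse p R j * η)) < rho p ^ (k + 1 - (j + 1)) := by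
      have := h33 (j + 1) (by omega) (by omega)
      rw [Nat.add_sub_cancel, ← div_eq_mul_inv, lt_div_iff₀ (by positivity), ← div_eq_mul_inv,
        lt_div_iff₀ (by positivity)] at this
      calc R j * (lam p R j ^ l (j + 1) * (Sse p R j * η))
          = ε (k + 1) * lam p R j ^ l (j + 1) * (R j * Sse p R j) / R (k + 1) ^ 2 := by
            rw [hηdef]; ring
        _ < _ := by rwa [div_lt_iff₀ (by positivity)]
    refine ⟨hbound, fun s hs => ?_⟩
    have hlast := he.norm_sub_le_last h hj (by omega) (y := fun i => y (L j + i))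
      (fun i => hy (L j + i))
      (hd.le.trans (pow_le_pow_of_le_one hρ.le (rho_lt_one p).le (by omega))) hd'
    rw [← hSeq] at hlast
    have hphi : phi p R (Sse p R j) = R j := by
      rw [hSeq]
      exact he.phi_iterate_norm h (t := 1) (Nat.sub_add_cancel hn)
    have hSle : Sse p R j ≤ R j := by
      rw [hSeq]
      exact (he.norm_lt_radius h (by omega)).le
    have hlamS : R j ≤ lam p R j * Sse p R j := by
      have := h.radii.phi_mul_le hS hSle
      rw [hphi] at this
      rwa [lam, div_mul_eq_mul_div, le_div_iff₀ hRj]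
    have hle1 : lam p R j ^ l (j + 1) * (Sse p R j * η) ≤ 1 := by
      have h1 : lam p R j ^ l (j + 1) * (Sse p R j * η) ≤
          R j * (lam p R j ^ l (j + 1) * (Sse p R j * η)) :=
        le_mul_of_one_le_left (by positivity) hRj1.le
      exact h1.trans (hbound.le.trans (pow_le_one₀ hρ.le (rho_lt_one p).le))
    have := h.norm_sub_le_of_mem_Bset hj (by omega) (x := fun i => x (L j + (m j + n j + i)))
      (y := fun i => y (L j + (m j + n j + i))) (fun i => hx _) (fun i => hy _)
      (hB j hj hjk) hlamS hlast hle1 hs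
    exact this
  have start : ∀ j, 1 ≤ j → j ≤ k → ‖y (L j) - x (L j)‖ < rho p ^ (k + 1 - j) ∧
      ‖y (L j) - x (L j)‖ ≤ rho p ^ 2 * p ^ m j * η := by
    intro j hj
    induction j, hj using Nat.le_induction with
    | base =>
      intro _
      rw [hL1, sub_self, norm_zero]
      exact ⟨by positivity, by positivity⟩
    | succ j hj ih =>
      intro hjk
      obtain ⟨hd, hd'⟩ := ih (by omega)
      obtain ⟨hbound, htail⟩ := tail j hj (by omega) hd hd'
      have hlast := htail _ le_rfl
      rw [← hL j hj] at hlast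
      refine ⟨hlast.trans_lt hbound, hlast.trans ?_⟩
      have := h34 (j + 1) (by omega) hjk
      rw [Nat.add_sub_cancel, ← div_eq_mul_inv, div_lt_one (by positivity), mul_assoc,
        ← div_eq_inv_mul, div_lt_iff₀ (by positivity)] at this
      calc R j * (lam p R j ^ l (j + 1) * (Sse p R j * η))
          = R j * Sse p R j * lam p R j ^ l (j + 1) * η := by ring
        _ ≤ p ^ m (j + 1) * rho p ^ 2 * η := by gcongr
        _ = _ := by ring
  obtain ⟨hd, hd'⟩ := start j hj hjk
  refine ⟨hd, hd', fun hlt s hs => ?_⟩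
  obtain ⟨hbound, htail⟩ := tail j hj hlt hd hd'
  have hRj := h.radii.pos hj
  have hRj1 : 1 < R j := hp1.trans (h.radii.prime_lt hj)
  have hS := h33.Sse_pos h.radii hε hj hlt
  have hlam : 1 ≤ lam p R j := (one_le_div hRj).2 (h.radii.lt_phi hRj1.le).le
  refine (htail s hs).trans_lt (lt_of_le_of_lt ?_
    (hbound.trans_le ((pow_le_one₀ hρ.le (rho_lt_one p).le).trans hRj1.le)))
  gcongr

lemma IsPerturbation.cylinder_subset
    (h : IsPerturbation p R c c' (k + 1) (ε (k + 1) / R (k + 1) ^ 2)) (hR : IsGenericRadii p R)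
    (hk : 1 ≤ k) (hε : 0 < ε (k + 1)) (hm : ∀ j, 1 ≤ j → 1 ≤ m j) (hl : ∀ j, 2 ≤ j → 1 ≤ l j)
    (h33 : Cond33 p R ε l (k + 1)) (h34 : Cond34 p R m l k) {z : K}
    (hz : ∀ i ≤ Nseq m (nseq p R) l k,
      (fc p c)^[i] z ∈ symbSet R c (itin m (nseq p R) l i)) :
    ∀ i ≤ Nseq m (nseq p R) l k,
      (fc p c')^[i] z ∈ symbSet R c' (itin m (nseq p R) l i) := by
  have hp1 : (1 : ℝ) < p := by exact_mod_cast hp.1.one_lt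
  have hρ := rho_pos p
  rw [forall_itin_iff hm hl hk (fun i a => (fc p c)^[i] z ∈ symbSet R c a)] at hz
  rw [forall_itin_iff hm hl hk (fun i a => (fc p c')^[i] z ∈ symbSet R c' a)]
  set n := nseq p R
  set L := Lseq m n l
  set x : ℕ → K := fun i => (fc p c)^[i] z with hxdef
  set y : ℕ → K := fun i => (fc p c')^[i] z with hydef
  have hx : ∀ i, x (i + 1) = fc p c (x i) := fun i => Function.iterate_succ_apply' _ _ _
  have hy : ∀ i, y (i + 1) = fc p c' (y i) := fun i => Function.iterate_succ_apply' _ _ _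
  have hL : ∀ j, 1 ≤ j → L (j + 1) = L j + (m j + n j + l (j + 1)) := fun j hj => by
    rw [show L (j + 1) = _ from Lseq_succ hj, add_assoc, add_assoc, ← add_assoc (m j)]
  have hnorm : ∀ {j : ℕ} {w : K}, 1 ≤ j → w ∈ Bset R c j → ‖w‖ = R j := fun {j w} hj hw => by
    rw [mem_Bset_iff hj, ← h.left j hj] at hw
    rw [← h.left j hj]
    exact norm_eq_of_norm_sub_lt hw
  have hexc : ∀ j, 1 ≤ j → j ≤ k → IsExcursion p R c (fun i => x (L j + i)) (m j) (n j) j :=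
    fun j hj hjk => ⟨fun i => hx _, h.radii.one_le_nseq j,
      fun s hs => by simpa [symbSet, Bset] using (hz j hj hjk).1 s hs,
      fun s hs => (hz j hj hjk).2.1 s hs, hnorm hj (hz j hj hjk).2.2.1⟩
  have hB : ∀ j, 1 ≤ j → j < k → ∀ s ≤ l (j + 1), ‖x (L j + (m j + n j + s))‖ ≤ R j := by
    intro j hj hjk s hs
    rcases hs.eq_or_lt with rfl | hs
    · rw [← hL j hj]
      have := (hexc (j + 1) (by omega) hjk).inner 0 (hm _ (by omega))
      exact this.le.trans (hp1.trans (h.radii.prime_lt hj)).le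
    · exact (hnorm hj ((hz j hj hjk.le).2.2.2 hjk s hs)).le
  intro j hj hjk
  obtain ⟨hd, -, htail⟩ :=
    h.norm_orbit_sub_lt hε h33 h34 hx hy rfl hL hexc hB hj hjk
  have he := hexc j hj hjk
  have hlt : ∀ s ≤ m j + n j, ‖y (L j + s) - x (L j + s)‖ < ‖x (L j + s)‖ := fun s hs =>
    he.norm_sub_lt h hj (by omega) (y := fun i => y (L j + i)) (fun i => hy _)
      (hd.trans_le (pow_le_of_le_one hρ.le (rho_lt_one p).le (by omega))) hs
  have hball : ∀ {w v : K}, w ∈ Bset R c j → ‖v - w‖ < R j → v ∈ Bset R c' j := by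
    intro w v hw hv
    rw [mem_Bset_iff hj] at hw ⊢
    rw [h.eq_of_ne j hj (by omega), ← sub_add_sub_cancel v w]
    exact (IsUltrametricDist.norm_add_le_max _ _).trans_lt (max_lt hv hw)
  refine ⟨fun s hs => ?_, fun s hs => ?_, ?_, fun hjk' s hs => ?_⟩
  · have : ‖y (L j + s)‖ < 1 := by
      rw [norm_eq_of_norm_sub_lt (hlt s (by omega))]
      exact he.inner s hs
    simpa [symbSet, Bset] using this
  · have heq : ‖y (L j + (m j + s))‖ = ‖x (L j + (m j + s))‖ :=
      norm_eq_of_norm_sub_lt (hlt _ (by omega))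
    refine mem_Aset_iff.2 ⟨?_, fun i hi => ?_⟩
    · exact (he.one_le_norm hs).trans_eq heq.symm
    · have hne : ‖y (L j + (m j + s))‖ ≠ ‖-c' i‖ := by
        rw [heq, norm_neg, h.right i hi]
        exact he.norm_ne_radius h hR hj hs hi
      have := IsUltrametricDist.norm_add_eq_max_of_norm_ne_norm hne
      rw [norm_neg, ← sub_eq_add_neg, h.right i hi] at this
      exact (le_max_right _ _).trans_eq this.symm
  · exact hball (hz j hj hjk).2.2.1 ((hlt _ le_rfl).trans_eq he.last)
  · exact hball ((hz j hj hjk).2.2.2 hjk' s hs) (htail hjk' s hs.le)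

end Stability

/-- **Lemma 5.7.** If (3.3) holds for `k+1` and (3.4) holds for `k`, then for
`c' ∈ U_{k+1}(c, ε_{k+1})` the cylinders of the truncated itinerary `α^{(k)}` for `f_c`
and `f_{c'}` coincide. -/
theorem cylinder_stability_single
    (p : ℕ) [Fact p.Prime] (K : Type*) [NontriviallyNormedField K] [Algebra ℚ_[p] K]
    (hK : IsCp p K) (R : ℕ → ℝ) (hR : IsGenericRadii p R)
    (k : ℕ) (hk : 1 ≤ k)
    (ε : ℕ → ℝ) (hε : ∀ j, 2 ≤ j → 0 < ε j ∧ ε j < R j)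
    (m : ℕ → ℕ) (hm : ∀ j, 1 ≤ j → 1 ≤ m j)
    (l : ℕ → ℕ) (hl : ∀ j, 2 ≤ j → 1 ≤ l j)
    (h33 : Cond33 p R ε l (k + 1))
    (h34 : Cond34 p R m l k)
    (c : ℕ → K) (hc : InC p R c)
    (c' : ℕ → K) (hc' : InU p R c (k + 1) (ε (k + 1)) c') :
    ∀ z : K,
      (∀ i, i ≤ Nseq m (nseq p R) l k →
          (fc p c)^[i] z ∈ symbSet R c (itin m (nseq p R) l i)) ↔
      (∀ i, i ≤ Nseq m (nseq p R) l k →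
          (fc p c')^[i] z ∈ symbSet R c' (itin m (nseq p R) l i)) := by
  have := hK.complete
  have : IsUltrametricDist K :=
    IsUltrametricDist.isUltrametricDist_of_forall_norm_add_le_max_norm hK.isNonarch
  have hpK : ‖(p : K)‖ = (p : ℝ)⁻¹ := by
    have := hK.norm_extends p
    rwa [map_natCast, Padic.norm_p] at this
  obtain ⟨hε0, hεR⟩ := hε (k + 1) (by omega)
  have hpos := hR.1.pos (Nat.le_add_left 1 k)
  have hmul : R (k + 1) * (ε (k + 1) / R (k + 1) ^ 2) < 1 := by
    rw [mul_div_assoc', div_lt_one (by positivity), pow_two]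
    gcongr
  have h : IsPerturbation p R c c' (k + 1) (ε (k + 1) / R (k + 1) ^ 2) :=
    ⟨hpK, hR.1, hc, hc'.1, Nat.le_add_left 1 k, hc'.2.2, by gcongr; exact hc'.2.1.le, hmul⟩
  have h' : IsPerturbation p R c' c (k + 1) (ε (k + 1) / R (k + 1) ^ 2) :=
    ⟨hpK, hR.1, hc'.1, hc, Nat.le_add_left 1 k, fun j hj hjk => (hc'.2.2 j hj hjk).symm,
      by gcongr; rw [norm_sub_rev]; exact hc'.2.1.le, hmul⟩
  exact fun z => ⟨h.cylinder_subset hR hk hε0 hm hl h33 h34,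
    h'.cylinder_subset hR hk hε0 hm hl h33 h34⟩
end
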